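/- Let R be a factorial domain, K a field of quotients of R, X an indeterminate over K, and 𝒫 a system of representatives of the atoms of R up to associates. Suppose there is a sequence (𝒫_i)_{i∈ℕ} of finite subsets of 𝒫 such that for every i ∈ ℕ there is some p ∈ 𝒫_i with i < |𝒫_i| = |{r + pR : r ∈ 𝒫_i}| = |R/pR| < |R/qR| < ∞ for all q ∈ 𝒫_i \ {p}. Then the elasticity of the multiplicative monoid Int(R)• is infinite: for every M ∈ ℕ there exist a non-unit h ∈ Int(R)•, m, n ∈ ℕ with m > M·n, and factorizations of h as a product of m atoms of Int(R)• and as a product of n atoms of Int(R)•. -/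

import Mathlib

open Pointwise Polynomial

namespace IVP

/-! ### Generic monoid-theoretic notions -/

section Generic

variable {M : Type*} [CommMonoid M]

/-- `u` is a unit of the (sub)monoid given by the subset `S`. -/
def IsMUnit (S : Set M) (u : M) : Prop := u ∈ S ∧ ∃ v ∈ S, u * v = 1

/-- divisibility within the (sub)monoid given by the subset `S`. -/
def MDvd (S : Set M) (x y : M) : Prop := ∃ c ∈ S, y = x * c

/-- `x` and `y` are associated in the (sub)monoid given by the subset `S`. -/
def MAssoc (S : Set M) (x y : M) : Prop := ∃ ε, IsMUnit S ε ∧ y = x * ε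

/-- `u` is an atom (irreducible element) of the (sub)monoid given by `S`. -/
def IsMAtom (S : Set M) (u : M) : Prop :=
  u ∈ S ∧ ¬ IsMUnit S u ∧ ∀ x ∈ S, ∀ y ∈ S, u = x * y → IsMUnit S x ∨ IsMUnit S y

/-- `p` is a prime element of the (sub)monoid given by `S`. -/
def IsMPrime (S : Set M) (p : M) : Prop :=
  p ∈ S ∧ ¬ IsMUnit S p ∧ ∀ a ∈ S, ∀ b ∈ S, MDvd S p (a * b) → MDvd S p a ∨ MDvd S p b

/-- `I` is an `s`-ideal of the (sub)monoid given by `S`. -/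
def IsSIdeal (S I : Set M) : Prop := I ⊆ S ∧ ∀ a ∈ I, ∀ h ∈ S, a * h ∈ I

/-- `I` is a prime `s`-ideal of the (sub)monoid given by `S`. -/
def IsPrimeSIdeal (S I : Set M) : Prop :=
  IsSIdeal S I ∧ ∀ a ∈ S, ∀ b ∈ S, a * b ∈ I → a ∈ I ∨ b ∈ I

/-- `I` is a height-one prime `s`-ideal (a minimal nonempty prime `s`-ideal) of `S`. -/
def IsHeightOnePrime (S I : Set M) : Prop :=
  IsPrimeSIdeal S I ∧ I.Nonempty ∧
    ∀ J : Set M, IsPrimeSIdeal S J → J.Nonempty → J ⊆ I → J = I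

/-- `T` is a divisor-closed submonoid of the (sub)monoid given by `S`. -/
def IsDivisorClosed (S T : Set M) : Prop :=
  T ⊆ S ∧ 1 ∈ T ∧ (∀ x ∈ T, ∀ y ∈ T, x * y ∈ T) ∧ ∀ x ∈ S, ∀ y ∈ S, x * y ∈ T → x ∈ T

/-- the (sub)monoid given by `S` is factorial: every non-unit is a product of primes. -/
def IsFactorialSet (S : Set M) : Prop :=
  ∀ x ∈ S, ¬ IsMUnit S x → ∃ l : List M, (∀ p ∈ l, IsMPrime S p) ∧ x = l.prod

/-- `X⁻¹ = {z ∣ z X ⊆ S}`, computed in an ambient monoid containing the quotients. -/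
def setInv (S X : Set M) : Set M := {z | ∀ x ∈ X, z * x ∈ S}

/-- the divisorial closure `X_v = (X⁻¹)⁻¹` relative to the (sub)monoid given by `S`. -/
def vcl (S X : Set M) : Set M := setInv S (setInv S X)

/-- `I` is a divisorial ideal (`v`-ideal) of the (sub)monoid given by `S`. -/
def IsVIdeal (S I : Set M) : Prop := I ⊆ S ∧ vcl S I = I

/-- `I` is a principal (`s`-)ideal of the (sub)monoid given by `S`. -/
def IsPrincipalIdl (S I : Set M) : Prop := ∃ a ∈ S, I = {a} * S

/-- the `P`-adic exponent of an ideal `I`, via `v_P(I) ≥ n ↔ I ⊆ (Pⁿ)_v`. -/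
noncomputable def vexp (S P I : Set M) : ℕ := sSup {n : ℕ | I ⊆ vcl S (P ^ n)}

/-- the exponent of `g` in `y`, i.e. `sup {n ∣ gⁿ ∣ y}`. -/
noncomputable def expOf (g y : M) : ℕ := sSup {n : ℕ | g ^ n ∣ y}

/-- two ideals lie in the same divisor class iff they differ by a principal factor. -/
def IdlRel (S : Set M) (P Q : Set M) : Prop := ∃ a ∈ S, ∃ b ∈ S, {b} * P = {a} * Q

theorem subset_vcl (S X : Set M) : X ⊆ vcl S X := by
  intro x hx z hz
  rw [mul_comm]
  exact hz x hx

theorem setInv_anti {S X Y : Set M} (h : X ⊆ Y) : setInv S Y ⊆ setInv S X :=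
  fun z hz x hx => hz x (h hx)

theorem vcl_mono {S X Y : Set M} (h : X ⊆ Y) : vcl S X ⊆ vcl S Y :=
  setInv_anti (setInv_anti h)

theorem setInv_vcl (S X : Set M) : setInv S (vcl S X) = setInv S X := by
  apply Set.Subset.antisymm (setInv_anti (subset_vcl S X))
  intro z hz y hy
  rw [mul_comm]
  exact hy z hz

theorem vcl_idem (S X : Set M) : vcl S (vcl S X) = vcl S X := by
  calc vcl S (vcl S X) = setInv S (setInv S (vcl S X)) := rfl
    _ = setInv S (setInv S X) := by rw [setInv_vcl]
    _ = vcl S X := rfl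

theorem hstab_vcl {S X : Set M} (hS : ∀ a ∈ S, ∀ b ∈ S, a * b ∈ S) :
    ∀ z ∈ vcl S X, ∀ h ∈ S, z * h ∈ vcl S X := by
  intro z hz h hh w hw
  have h1 : z * w ∈ S := hz w hw
  have e : z * h * w = z * w * h := mul_right_comm z h w
  rw [e]
  exact hS _ h1 _ hh

theorem bound_vcl {S X : Set M} {c : M} (hc : ∀ x ∈ X, c * x ∈ S) :
    ∀ y ∈ vcl S X, c * y ∈ S := by
  intro y hy
  rw [mul_comm]
  exact hy c hc

theorem mul_subset_vcl_mul (S X Y : Set M) : vcl S X * Y ⊆ vcl S (X * Y) := by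
  rintro _ ⟨a, ha, b, hb, rfl⟩ z hz
  have hzb : ∀ x ∈ X, (z * b) * x ∈ S := by
    intro x hx
    have hxb : x * b ∈ X * Y := Set.mul_mem_mul hx hb
    have h1 := hz _ hxb
    have e : z * b * x = z * (x * b) := by
      rw [mul_assoc, mul_comm b x]
    rw [e]
    exact h1
  have h2 : a * (z * b) ∈ S := ha _ hzb
  have e2 : a * b * z = a * (z * b) := by
    rw [mul_assoc, mul_comm b z]
  rw [e2]
  exact h2

theorem vcl_mul_vcl_left (S X Y : Set M) : vcl S (vcl S X * Y) = vcl S (X * Y) := by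
  apply Set.Subset.antisymm
  · have h1 := vcl_mono (S := S) (mul_subset_vcl_mul S X Y)
    rwa [vcl_idem] at h1
  · exact vcl_mono (Set.mul_subset_mul (subset_vcl S X) subset_rfl)

theorem vcl_mul_vcl_right (S X Y : Set M) : vcl S (X * vcl S Y) = vcl S (X * Y) := by
  rw [mul_comm X, vcl_mul_vcl_left, mul_comm]

theorem coe_mul_self (H : Submonoid M) : (H : Set M) * (H : Set M) = (H : Set M) := by
  apply Set.Subset.antisymm
  · rintro _ ⟨a, ha, b, hb, rfl⟩
    exact mul_mem ha hb
  · intro x hx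
    exact ⟨x, hx, 1, H.one_mem, mul_one x⟩

theorem setInv_coe (H : Submonoid M) : setInv (H : Set M) (H : Set M) = (H : Set M) := by
  apply Set.Subset.antisymm
  · intro z hz
    have h1 := hz 1 H.one_mem
    rwa [mul_one] at h1
  · intro h hh x hx
    exact mul_mem hh hx

theorem vcl_coe (H : Submonoid M) : vcl (H : Set M) (H : Set M) = (H : Set M) := by
  unfold vcl
  rw [setInv_coe, setInv_coe]

theorem coe_mul_eq (H : Submonoid M) {I : Set M} (hI : vcl (H : Set M) I = I) :
    (H : Set M) * I = I := by
  apply Set.Subset.antisymm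
  · rintro _ ⟨h, hh, y, hy, rfl⟩
    show h * y ∈ I
    rw [mul_comm]
    rw [← hI] at hy ⊢
    exact hstab_vcl (fun a ha b hb => mul_mem ha hb) y hy h hh
  · intro x hx
    exact ⟨1, H.one_mem, x, hx, one_mul x⟩

/-- the setoid identifying height-one primes lying in the same divisor class. -/
def primeSetoid (H : Submonoid M) : Setoid {P : Set M // IsHeightOnePrime (H : Set M) P} where
  r P Q := IdlRel (H : Set M) P.1 Q.1
  iseqv := by
    constructor
    · exact fun P => ⟨1, H.one_mem, 1, H.one_mem, rfl⟩
    · rintro P Q ⟨a, ha, b, hb, h⟩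
      exact ⟨b, hb, a, ha, h.symm⟩
    · rintro P Q S ⟨a, ha, b, hb, h1⟩ ⟨a', ha', b', hb', h2⟩
      refine ⟨a * a', mul_mem ha ha', b' * b, mul_mem hb' hb, ?_⟩
      calc ({b' * b} : Set M) * P.1 = {b'} * ({b} * P.1) := by
            rw [← mul_assoc, Set.singleton_mul_singleton]
        _ = {b'} * ({a} * Q.1) := by rw [h1]
        _ = {a} * ({b'} * Q.1) := by
            rw [← mul_assoc, mul_comm ({b'} : Set M) ({a} : Set M), mul_assoc]
        _ = {a} * ({a'} * S.1) := by rw [h2]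
        _ = {a * a'} * S.1 := by rw [← mul_assoc, Set.singleton_mul_singleton]

end Generic

/-! ### Krull monoids -/

section Krull

variable {G : Type*} [CommGroup G]

/-- `H` is completely integrally closed (in its quotient group). -/
def IsCIC (H : Submonoid G) : Prop :=
  ∀ x : G, (∃ c ∈ H, ∀ n : ℕ, c * x ^ n ∈ H) → x ∈ H

/-- `H` is a Mori monoid: the ascending chain condition on divisorial ideals holds. -/
def IsMori (H : Submonoid G) : Prop :=
  ∀ I : ℕ → Set G, (∀ n, (I n).Nonempty ∧ IsVIdeal (H : Set G) (I n)) →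
    (∀ n, I n ⊆ I (n + 1)) → ∃ N, ∀ m, N ≤ m → I m = I N

/-- `H` is a Krull monoid, i.e. a completely integrally closed Mori monoid. -/
def IsKrullMonoid (H : Submonoid G) : Prop := IsCIC H ∧ IsMori H

/-- `H ⊆ T` is a saturated submonoid. -/
def IsSaturated (H T : Submonoid G) : Prop :=
  ∀ x ∈ H, ∀ y ∈ H, (∃ t ∈ T, y = x * t) → ∃ h ∈ H, y = x * h

end Krull

/-! ### The divisor-class group of a submonoid of (the multiplicative monoid of) a field -/

section ClassGrp

variable {F : Type*} [Field F]

/-- `I` is a fractional divisorial ideal of `H`. -/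
def IsFracVIdl (H : Submonoid F) (I : Set F) : Prop :=
  I.Nonempty ∧ (∃ a : F, a ≠ 0 ∧ ∀ x ∈ I, a * x ∈ H) ∧ vcl (H : Set F) I = I

/-- the type of fractional divisorial ideals of `H`. -/
def FIdl (H : Submonoid F) : Type _ := {I : Set F // IsFracVIdl H I}

theorem isFracVIdl_coe (H : Submonoid F) : IsFracVIdl H (H : Set F) :=
  ⟨⟨1, H.one_mem⟩, ⟨1, one_ne_zero, fun x hx => by rwa [one_mul]⟩, vcl_coe H⟩

theorem isFracVIdl_mul {H : Submonoid F} {I J : Set F}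
    (hI : IsFracVIdl H I) (hJ : IsFracVIdl H J) :
    IsFracVIdl H (vcl (H : Set F) (I * J)) := by
  obtain ⟨hne, ⟨a, ha0, ha⟩, hIv⟩ := hI
  obtain ⟨hne', ⟨b, hb0, hb⟩, hJv⟩ := hJ
  refine ⟨(hne.mul hne').mono (subset_vcl _ _), ⟨a * b, mul_ne_zero ha0 hb0, ?_⟩,
    vcl_idem _ _⟩
  intro x hx
  refine bound_vcl ?_ x hx
  rintro _ ⟨u, hu, v, hv, rfl⟩
  have e : a * b * (u * v) = (a * u) * (b * v) := by ring
  rw [e]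
  exact mul_mem (ha u hu) (hb v hv)

instance (H : Submonoid F) : CommMonoid (FIdl H) where
  mul I J := ⟨vcl (H : Set F) (I.1 * J.1), isFracVIdl_mul I.2 J.2⟩
  one := ⟨(H : Set F), isFracVIdl_coe H⟩
  mul_assoc I J K := by
    apply Subtype.ext
    show vcl _ (vcl _ (I.1 * J.1) * K.1) = vcl _ (I.1 * vcl _ (J.1 * K.1))
    rw [vcl_mul_vcl_left, vcl_mul_vcl_right, mul_assoc]
  one_mul I := by
    apply Subtype.ext
    show vcl _ ((H : Set F) * I.1) = I.1
    rw [coe_mul_eq H I.2.2.2, I.2.2.2]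
  mul_one I := by
    apply Subtype.ext
    show vcl _ (I.1 * (H : Set F)) = I.1
    rw [mul_comm, coe_mul_eq H I.2.2.2, I.2.2.2]
  mul_comm I J := by
    apply Subtype.ext
    show vcl _ (I.1 * J.1) = vcl _ (J.1 * I.1)
    rw [mul_comm]

theorem setInv_prin (H : Submonoid F) {a : F} (ha : a ≠ 0) :
    setInv (H : Set F) ({a} * (H : Set F)) = {a⁻¹} * (H : Set F) := by
  apply Set.Subset.antisymm
  · intro z hz
    have h1 : z * (a * 1) ∈ H := hz _ (Set.mul_mem_mul rfl H.one_mem)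
    rw [mul_one] at h1
    refine ⟨a⁻¹, rfl, z * a, h1, ?_⟩
    show a⁻¹ * (z * a) = z
    rw [mul_comm z a, ← mul_assoc, inv_mul_cancel₀ ha, one_mul]
  · rintro _ ⟨s, hs, h, hh, rfl⟩ _ ⟨t, ht, k, hk, rfl⟩
    rw [Set.mem_singleton_iff] at hs ht
    rw [hs, ht]
    have e : a⁻¹ * h * (a * k) = (a⁻¹ * a) * (h * k) := by ring
    rw [e, inv_mul_cancel₀ ha, one_mul]
    exact mul_mem hh hk

theorem isFracVIdl_prin (H : Submonoid F) {a : F} (ha : a ≠ 0) :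
    IsFracVIdl H ({a} * (H : Set F)) := by
  refine ⟨⟨a * 1, Set.mul_mem_mul rfl H.one_mem⟩, ⟨a⁻¹, inv_ne_zero ha, ?_⟩, ?_⟩
  · rintro _ ⟨s, hs, h, hh, rfl⟩
    rw [Set.mem_singleton_iff] at hs
    rw [hs]
    have e : a⁻¹ * (a * h) = (a⁻¹ * a) * h := by ring
    rw [e, inv_mul_cancel₀ ha, one_mul]
    exact hh
  · unfold vcl
    rw [setInv_prin H ha, setInv_prin H (inv_ne_zero ha), inv_inv]

theorem prin_mul_set (H : Submonoid F) (a b : F) :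
    ({a} * (H : Set F)) * ({b} * (H : Set F)) = {a * b} * (H : Set F) := by
  rw [mul_mul_mul_comm, Set.singleton_mul_singleton, coe_mul_self]

/-- the homomorphism sending `a` to the principal fractional ideal `aH`. -/
def prinHom (H : Submonoid F) : Fˣ →* (FIdl H)ˣ where
  toFun a :=
    { val := ⟨{(a : F)} * (H : Set F), isFracVIdl_prin H a.ne_zero⟩
      inv := ⟨{((a⁻¹ : Fˣ) : F)} * (H : Set F), isFracVIdl_prin H a⁻¹.ne_zero⟩
      val_inv := by
        apply Subtype.ext
        show vcl (H : Set F) (({(a : F)} * (H : Set F)) * ({((a⁻¹ : Fˣ) : F)} * (H : Set F)))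
          = (H : Set F)
        rw [prin_mul_set, Units.mul_inv, Set.singleton_one, one_mul, vcl_coe]
      inv_val := by
        apply Subtype.ext
        show vcl (H : Set F) (({((a⁻¹ : Fˣ) : F)} * (H : Set F)) * ({(a : F)} * (H : Set F)))
          = (H : Set F)
        rw [prin_mul_set, Units.inv_mul, Set.singleton_one, one_mul, vcl_coe] }
  map_one' := by
    apply Units.ext
    apply Subtype.ext
    show ({((1 : Fˣ) : F)} : Set F) * (H : Set F) = (H : Set F)
    rw [Units.val_one, Set.singleton_one, one_mul]
  map_mul' a b := by
    apply Units.ext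
    apply Subtype.ext
    show ({((a * b : Fˣ) : F)} : Set F) * (H : Set F)
      = vcl (H : Set F) (({(a : F)} * (H : Set F)) * ({(b : F)} * (H : Set F)))
    rw [prin_mul_set, Units.val_mul,
      (isFracVIdl_prin H (mul_ne_zero a.ne_zero b.ne_zero)).2.2]

/-- the divisor-class group: `v`-invertible fractional `v`-ideals modulo principal ones. -/
def ClassGrp (H : Submonoid F) : Type _ := (FIdl H)ˣ ⧸ (prinHom H).range

instance (H : Submonoid F) : CommGroup (ClassGrp H) :=
  inferInstanceAs (CommGroup ((FIdl H)ˣ ⧸ (prinHom H).range))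

end ClassGrp

/-! ### Integer-valued polynomials over a factorial domain -/

section IntR

variable (R : Type*) [CommRing R] [IsDomain R] [UniqueFactorizationMonoid R]

/-- the quotient field of `R`. -/
abbrev Kq := FractionRing R

/-- the polynomial ring `K[X]` over the quotient field of `R`. -/
abbrev PK := Polynomial (Kq R)

/-- the field of rational functions, containing the quotient group of `Int(R)•`. -/
abbrev FF := FractionRing (PK R)

/-- the constant polynomial given by `r : R`. -/
noncomputable def cpoly (r : R) : PK R := Polynomial.C (algebraMap R (Kq R) r)

/-- the set of integer-valued polynomials: `g ∈ K[X]` with `g(R) ⊆ R`. -/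
def intSet : Set (PK R) :=
  {g | ∀ x : R, ∃ r : R, Polynomial.eval (algebraMap R (Kq R) x) g = algebraMap R (Kq R) r}

/-- the monadic submonoid `[[f]]` of `Int(R)•` generated by `f`. -/
def mon (f : PK R) : Set (PK R) :=
  {g | g ∈ intSet R ∧ g ≠ 0 ∧ ∃ k : ℕ, ∃ h ∈ intSet R, g * h = f ^ k}

/-- the subring `R[X]`: polynomials all of whose coefficients lie in `R`. -/
def rxSet : Set (PK R) :=
  {g | ∀ n : ℕ, ∃ r : R, g.coeff n = algebraMap R (Kq R) r}

/-- the multiplicative monoid `R[X]•`. -/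
def rxnz : Set (PK R) := {g | g ∈ rxSet R ∧ g ≠ 0}

/-- the multiplicative monoid `Int(R)•`. -/
def intnz : Set (PK R) := {g | g ∈ intSet R ∧ g ≠ 0}

/-- `g` is a primitive polynomial in `R[X]`: every common divisor of its coefficients
is a unit of `R`. -/
def IsPrimPoly (g : PK R) : Prop :=
  ∀ r : R, (∀ n : ℕ, ∃ s : R, g.coeff n = algebraMap R (Kq R) (r * s)) → IsUnit r

/-- `d` is an image-content function: `d g` is a greatest common divisor (in `R`)
of the image `g(R)`. -/
def IsImageGcdFun (d : PK R → R) : Prop :=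
  ∀ g ∈ intSet R, g ≠ 0 →
    (∀ x : R, ∃ r : R,
        Polynomial.eval (algebraMap R (Kq R) x) g = algebraMap R (Kq R) (d g * r)) ∧
      ∀ r : R, (∀ x : R, ∃ s : R,
          Polynomial.eval (algebraMap R (Kq R) x) g = algebraMap R (Kq R) (r * s)) →
        r ∣ d g

/-- `e` is a least common multiple in `R` of the set `{d(g·h)/d(h) : h ∈ [[f]]}`,
i.e. `e = e_f(g)` up to associates. -/
def IsEfVal (d : PK R → R) (f g : PK R) (e : R) : Prop :=
  (∀ h ∈ mon R f, d (g * h) ∣ d h * e) ∧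
    ∀ r : R, (∀ h ∈ mon R f, d (g * h) ∣ d h * r) → e ∣ r

theorem intSet_one : (1 : PK R) ∈ intSet R := fun _ => ⟨1, by simp⟩

theorem intSet_mul {g h : PK R} (hg : g ∈ intSet R) (hh : h ∈ intSet R) :
    g * h ∈ intSet R := by
  intro x
  obtain ⟨r, hr⟩ := hg x
  obtain ⟨s, hs⟩ := hh x
  exact ⟨r * s, by rw [Polynomial.eval_mul, hr, hs, map_mul]⟩

theorem mon_one (f : PK R) : (1 : PK R) ∈ mon R f :=
  ⟨intSet_one R, one_ne_zero, 0, 1, intSet_one R, by simp⟩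

theorem mon_mul {f g h : PK R} (hg : g ∈ mon R f) (hh : h ∈ mon R f) :
    g * h ∈ mon R f := by
  obtain ⟨hgI, hg0, k, a, haI, hka⟩ := hg
  obtain ⟨hhI, hh0, l, b, hbI, hlb⟩ := hh
  refine ⟨intSet_mul R hgI hhI, mul_ne_zero hg0 hh0, k + l, a * b, intSet_mul R haI hbI, ?_⟩
  rw [pow_add, ← hka, ← hlb]
  ring

/-- the monadic submonoid `[[f]]`, viewed inside the field of rational functions. -/
noncomputable def Hmon (f : PK R) : Submonoid (FF R) where
  carrier := algebraMap (PK R) (FF R) '' mon R f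
  one_mem' := ⟨1, mon_one R f, map_one _⟩
  mul_mem' := by
    rintro x y ⟨a, ha, rfl⟩ ⟨b, hb, rfl⟩
    exact ⟨a * b, mon_mul R ha hb, map_mul _ _ _⟩

/-- the ideal `gK[X] ∩ [[f]]`, at the level of polynomials. -/
def pIdlP (f g : PK R) : Set (PK R) := {z | z ∈ mon R f ∧ ∃ h : PK R, z = g * h}

/-- the ideal `gK[X] ∩ [[f]]`, inside the field of rational functions. -/
noncomputable def pIdl (f g : PK R) : Set (FF R) := algebraMap (PK R) (FF R) '' pIdlP R f g

end IntR

end IVP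

open IVP Pointwise Polynomial
section Helpers

variable {R : Type*} [CommRing R] [IsDomain R] [UniqueFactorizationMonoid R]

theorem hlp_const_mem {c : Kq R} (v : R → R)
    (hc : ∀ x, ∃ r : R, c * algebraMap R (Kq R) (v x) = algebraMap R (Kq R) r)
    (hv : ∀ q : R, Prime q → ∃ x, ¬ q ∣ v x) : ∃ r : R, c = algebraMap R (Kq R) r := by
  obtain ⟨a, b, hrel, hab⟩ := IsFractionRing.exists_reduced_fraction R c
  have hb0 : (b : R) ≠ 0 := nonZeroDivisors.ne_zero b.2
  have hbK : algebraMap R (Kq R) b ≠ 0 := by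
    simpa using hb0
  have hcb : c * algebraMap R (Kq R) b = algebraMap R (Kq R) a := by
    rw [← hab]; exact IsLocalization.mk'_spec _ _ _
  by_cases hu : IsUnit (b : R)
  · obtain ⟨w, hw⟩ := hu.exists_right_inv
    refine ⟨a * w, ?_⟩
    rw [map_mul, ← hcb, mul_assoc, ← map_mul, hw, map_one, mul_one]
  · exfalso
    obtain ⟨q, hq, hqb⟩ := WfDvdMonoid.exists_irreducible_factor hu hb0
    have hqp := UniqueFactorizationMonoid.irreducible_iff_prime.mp hq
    obtain ⟨x, hx⟩ := hv q hqp
    obtain ⟨r, hr⟩ := hc x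
    have h1 : a * v x = r * b := by
      apply IsFractionRing.injective R (Kq R)
      rw [map_mul, map_mul, ← hcb, ← hr]; ring
    have h2 : q ∣ a * v x := h1 ▸ Dvd.dvd.mul_left hqb r
    rcases hqp.dvd_or_dvd h2 with h | h
    · exact hq.not_isUnit (hrel h hqb)
    · exact hx h

/-- product of the linear factors over `A`. -/
noncomputable def gP (A : Finset R) : PK R := ∏ r ∈ A, (X - C (algebraMap R (Kq R) r))

theorem gP_ne (A : Finset R) : gP A ≠ 0 :=
  Finset.prod_ne_zero_iff.mpr fun _ _ => X_sub_C_ne_zero _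

theorem gP_eval (A : Finset R) (x : R) :
    eval (algebraMap R (Kq R) x) (gP A) = algebraMap R (Kq R) (∏ r ∈ A, (x - r)) := by
  simp [gP, eval_prod]

theorem gP_deg (A : Finset R) : (gP A).natDegree = A.card := by
  unfold gP
  rw [natDegree_prod_of_monic _ _ (fun _ _ => monic_X_sub_C _)]
  simp

theorem hlp_unit_C {a b : R} (h : a * b = 1) : IsMUnit (intnz R) (C (algebraMap R (Kq R) a)) := by
  have key : ∀ a b : R, a * b = 1 → C (algebraMap R (Kq R) a) ∈ intnz R := by
    intro a b h
    refine ⟨fun x => ⟨a, by simp⟩, ?_⟩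
    have : a ≠ 0 := left_ne_zero_of_mul_eq_one h
    simpa using this
  refine ⟨key a b h, C (algebraMap R (Kq R) b), key b a (by rw [mul_comm, h]), ?_⟩
  rw [← C_mul, ← map_mul, h]; simp

theorem hlp_unit_deg {u : PK R} (h : IsMUnit (intnz R) u) : u.natDegree = 0 := by
  obtain ⟨_, v, _, huv⟩ := h
  exact natDegree_eq_zero_of_isUnit (IsUnit.of_mul_eq_one v huv)

theorem hlp_const_atom {p : R} (hp : Irreducible p) :
    IsMAtom (intnz R) (C (algebraMap R (Kq R) p)) := by
  have hp0 : algebraMap R (Kq R) p ≠ 0 := by simpa using hp.ne_zero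
  refine ⟨⟨fun x => ⟨p, by simp⟩, by simpa using hp.ne_zero⟩, ?_, ?_⟩
  · rintro ⟨_, v, ⟨hv, _⟩, h⟩
    obtain ⟨r, hr⟩ := hv 0
    have h1 := congrArg (eval (algebraMap R (Kq R) 0)) h
    rw [eval_mul, eval_C, hr, eval_one, ← map_mul, ← map_one (algebraMap R (Kq R))] at h1
    exact hp.not_isUnit (IsUnit.of_mul_eq_one r (IsFractionRing.injective R (Kq R) h1))
  · intro x hx y hy hxy
    have hu : IsUnit (x * y) := by
      rw [← hxy]; exact isUnit_C.mpr (isUnit_iff_ne_zero.mpr hp0)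
    obtain ⟨a, ha⟩ := natDegree_eq_zero.mp (natDegree_eq_zero_of_isUnit (isUnit_of_mul_isUnit_left hu))
    obtain ⟨b, hb⟩ := natDegree_eq_zero.mp (natDegree_eq_zero_of_isUnit (isUnit_of_mul_isUnit_right hu))
    obtain ⟨r, hr⟩ := hx.1 0
    obtain ⟨s, hs⟩ := hy.1 0
    rw [← ha, eval_C] at hr
    rw [← hb, eval_C] at hs
    subst hr hs
    rw [← ha, ← hb, ← C_mul, ← map_mul] at hxy
    have h1 := IsFractionRing.injective R (Kq R) (C_injective hxy)
    rw [← ha, ← hb]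
    rcases hp.isUnit_or_isUnit h1 with h | h
    · obtain ⟨w, hw⟩ := h.exists_right_inv
      exact Or.inl (hlp_unit_C hw)
    · obtain ⟨w, hw⟩ := h.exists_right_inv
      exact Or.inr (hlp_unit_C hw)

theorem hlp_atom (A : Finset R) (hA : A.Nonempty) (e : R) (he : e ≠ 0)
    (hdiv : ∀ x, e ∣ ∏ r ∈ A, (x - r))
    (h1 : ∀ B ⊂ A, B.Nonempty →
      ¬ IsUnit e ∧ ∀ q : R, Prime q → ∃ x, ¬ q ∣ ∏ r ∈ B, (x - r))
    (h2 : ∀ q : R, Prime q → ∃ x, ¬ (q * e) ∣ ∏ r ∈ A, (x - r)) :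
    IsMAtom (intnz R) (C (algebraMap R (Kq R) e)⁻¹ * gP A) := by
  classical
  have he0 : algebraMap R (Kq R) e ≠ 0 := by simpa using he
  have hC0 : (C (algebraMap R (Kq R) e)⁻¹ : PK R) ≠ 0 := by simpa using he
  have hne : C (algebraMap R (Kq R) e)⁻¹ * gP A ≠ 0 := mul_ne_zero hC0 (gP_ne A)
  refine ⟨⟨fun x => ?_, hne⟩, ?_, ?_⟩
  · obtain ⟨s, hs⟩ := hdiv x
    refine ⟨s, ?_⟩
    rw [eval_mul, eval_C, gP_eval, hs, map_mul, inv_mul_cancel_left₀ he0]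
  · intro hu
    have := hlp_unit_deg hu
    rw [natDegree_mul hC0 (gP_ne A), natDegree_C, gP_deg, zero_add] at this
    exact hA.card_ne_zero this
  -- the one-sided case
  have side : ∀ β γ : Kq R, β * γ = (algebraMap R (Kq R) e)⁻¹ → (C β : PK R) ∈ intnz R →
      C γ * gP A ∈ intnz R → IsMUnit (intnz R) (C β : PK R) := by
    intro β γ hβγ hβ hγ
    obtain ⟨c, hc⟩ := hβ.1 0
    rw [eval_C] at hc
    subst hc
    have hc0 : c ≠ 0 := by
      rintro rfl
      exact hβ.2 (by simp)
    by_cases hu : IsUnit c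
    · obtain ⟨w, hw⟩ := hu.exists_right_inv
      exact hlp_unit_C hw
    · exfalso
      obtain ⟨q, hq, d, rfl⟩ := WfDvdMonoid.exists_irreducible_factor hu hc0
      obtain ⟨x, hx⟩ := h2 q (UniqueFactorizationMonoid.irreducible_iff_prime.mp hq)
      apply hx
      obtain ⟨s, hs⟩ := hγ.1 x
      rw [eval_mul, eval_C, gP_eval] at hs
      refine ⟨d * s, ?_⟩
      apply IsFractionRing.injective R (Kq R)
      have h3 : algebraMap R (Kq R) e * (algebraMap R (Kq R) (q * d) * γ) = 1 := by
        rw [hβγ, mul_inv_cancel₀ he0]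
      calc algebraMap R (Kq R) (∏ r ∈ A, (x - r))
          = (algebraMap R (Kq R) e * (algebraMap R (Kq R) (q * d) * γ)) *
            algebraMap R (Kq R) (∏ r ∈ A, (x - r)) := by rw [h3, one_mul]
        _ = algebraMap R (Kq R) e * algebraMap R (Kq R) (q * d) *
            (γ * algebraMap R (Kq R) (∏ r ∈ A, (x - r))) := by ring
        _ = _ := by rw [hs]; simp only [map_mul]; ring
  intro x hx y hy hxy
  obtain ⟨t, u, b, c, htu, hdis, hbc, hxb, hyc⟩ := mul_eq_mul_prime_prod
    (p := fun r : R => (X - C (algebraMap R (Kq R) r) : PK R))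
    (fun r _ => prime_X_sub_C _) hxy.symm
  have hU : IsUnit (b * c) := by
    rw [← hbc]; exact isUnit_C.mpr (isUnit_iff_ne_zero.mpr (inv_ne_zero he0))
  obtain ⟨β, rfl⟩ := natDegree_eq_zero.mp (natDegree_eq_zero_of_isUnit (isUnit_of_mul_isUnit_left hU))
  obtain ⟨γ, rfl⟩ := natDegree_eq_zero.mp (natDegree_eq_zero_of_isUnit (isUnit_of_mul_isUnit_right hU))
  have hβγ : β * γ = (algebraMap R (Kq R) e)⁻¹ := by
    rw [← C_mul] at hbc; exact (C_injective hbc).symm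
  change x = C β * gP t at hxb
  change y = C γ * gP u at hyc
  rcases t.eq_empty_or_nonempty with ht | ht
  · subst ht
    left
    rw [Finset.empty_union] at htu
    subst htu
    have hx' : x = C β := by rw [hxb]; simp [gP]
    rw [hx'] at hx ⊢
    rw [hyc] at hy
    exact side β γ hβγ hx hy
  rcases u.eq_empty_or_nonempty with hu | hu
  · subst hu
    right
    rw [Finset.union_empty] at htu
    subst htu
    have hy' : y = C γ := by rw [hyc]; simp [gP]
    rw [hy'] at hy ⊢
    rw [hxb] at hx
    exact side γ β (by rw [mul_comm, hβγ]) hy hx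
  exfalso
  have htA : t ⊂ A := by
    rw [← htu]
    refine Finset.ssubset_iff_subset_ne.mpr ⟨Finset.subset_union_left, fun h => ?_⟩
    obtain ⟨z, hz⟩ := hu
    have hzt : z ∈ t := by rw [h]; exact Finset.mem_union_right _ hz
    exact Finset.disjoint_left.mp hdis hzt hz
  have huA : u ⊂ A := by
    rw [← htu]
    refine Finset.ssubset_iff_subset_ne.mpr ⟨Finset.subset_union_right, fun h => ?_⟩
    obtain ⟨z, hz⟩ := ht
    have hzu : z ∈ u := by rw [h]; exact Finset.mem_union_left _ hz
    exact Finset.disjoint_left.mp hdis hz hzu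
  have mem : ∀ (B : Finset R) (κ : Kq R), B ⊂ A → B.Nonempty → C κ * gP B ∈ intnz R →
      ∃ r, κ = algebraMap R (Kq R) r := by
    intro B κ hB hBn hm
    refine hlp_const_mem (fun x => ∏ r ∈ B, (x - r)) (fun x => ?_) (h1 B hB hBn).2
    obtain ⟨r, hr⟩ := hm.1 x
    rw [eval_mul, eval_C, gP_eval] at hr
    exact ⟨r, hr⟩
  obtain ⟨r, rfl⟩ := mem t β htA ht (hxb ▸ hx)
  obtain ⟨s, rfl⟩ := mem u γ huA hu (hyc ▸ hy)
  apply (h1 t htA ht).1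
  refine IsUnit.of_mul_eq_one (r * s) ?_
  apply IsFractionRing.injective R (Kq R)
  rw [map_mul, map_mul, hβγ, mul_inv_cancel₀ he0, map_one]

theorem hlp_linear_atom (r : R) : IsMAtom (intnz R) (X - C (algebraMap R (Kq R) r)) := by
  have := hlp_atom {r} (Finset.singleton_nonempty r) 1 one_ne_zero (fun x => one_dvd _)
    (fun B hB hn => by
      exfalso
      rw [Finset.ssubset_singleton_iff] at hB
      simp [hB] at hn)
    (fun q hq => ⟨r + 1, by
      simpa [← isUnit_iff_dvd_one] using hq.not_isUnit⟩)
  simpa [gP] using this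

theorem hlp_avoid {q : R} (hq : Prime q) (A : Finset R)
    (h : A.card < Nat.card (R ⧸ Ideal.span {q})) : ∃ x, ¬ q ∣ ∏ r ∈ A, (x - r) := by
  classical
  have : ∃ y : R ⧸ Ideal.span {q}, y ∉ A.image (Ideal.Quotient.mk (Ideal.span {q})) := by
    by_contra! hall
    have h1 : (A.image (Ideal.Quotient.mk (Ideal.span {q})) : Set (R ⧸ Ideal.span {q}))
        = Set.univ := Set.eq_univ_of_forall fun y => by exact_mod_cast hall y
    have h2 := Set.ncard_univ (R ⧸ Ideal.span {q})
    rw [← h1, Set.ncard_coe_finset] at h2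
    have h3 := Finset.card_image_le (s := A) (f := Ideal.Quotient.mk (Ideal.span {q}))
    omega
  obtain ⟨y, hy⟩ := this
  obtain ⟨x, rfl⟩ := Ideal.Quotient.mk_surjective y
  refine ⟨x, fun hd => ?_⟩
  obtain ⟨r, hr, hd⟩ := (hq.dvd_finsetProd_iff _).mp hd
  apply hy
  refine Finset.mem_image.mpr ⟨r, hr, ?_⟩
  symm
  rw [Ideal.Quotient.eq, Ideal.mem_span_singleton]
  exact hd

end Helpers

/-- Theorem `main2`, elasticity part. -/
theorem stmt_19 (R : Type*) [CommRing R] [IsDomain R] [UniqueFactorizationMonoid R]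
    (Ps : Set R) (hPs1 : ∀ p ∈ Ps, Irreducible p)
    (hPs2 : ∀ q : R, Irreducible q → ∃! p, p ∈ Ps ∧ Associated q p)
    (P : ℕ → Finset R) (hPPs : ∀ i, ↑(P i) ⊆ Ps)
    (hseq : ∀ i : ℕ, ∃ p ∈ P i,
      Finite (R ⧸ Ideal.span {p}) ∧
      i < (P i).card ∧
      (P i).card = Set.ncard ((fun r => Ideal.Quotient.mk (Ideal.span {p}) r) '' ↑(P i)) ∧
      (P i).card = Nat.card (R ⧸ Ideal.span {p}) ∧
      ∀ q ∈ P i, q ≠ p →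
        Finite (R ⧸ Ideal.span {q}) ∧
          Nat.card (R ⧸ Ideal.span {p}) < Nat.card (R ⧸ Ideal.span {q})) :
    ∀ M : ℕ, ∃ h ∈ intnz R, ¬ IsMUnit (intnz R) h ∧
      ∃ l₁ l₂ : List (PK R),
        (∀ p ∈ l₁, IsMAtom (intnz R) p) ∧ (∀ p ∈ l₂, IsMAtom (intnz R) p) ∧
        l₁.prod = h ∧ l₂.prod = h ∧ M * l₂.length < l₁.length := by
  classical
  intro M
  obtain ⟨p, hpP, hfin, hi, hcard1, hcard2, hq⟩ := hseq (2 * M)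
  generalize hA : P (2 * M) = A at *
  have hAPs : ∀ r ∈ A, r ∈ Ps := fun r hr => hPPs (2 * M) (by rw [hA]; exact hr)
  have hirr : ∀ r ∈ A, Irreducible r := fun r hr => hPs1 r (hAPs r hr)
  have hprime : ∀ r ∈ A, Prime r := fun r hr =>
    UniqueFactorizationMonoid.irreducible_iff_prime.mp (hirr r hr)
  have hdvd : ∀ r ∈ A, ∀ s ∈ A, r ∣ s → r = s := by
    intro r hr s hs hrs
    have has : Associated r s := (hirr r hr).associated_of_dvd (hirr s hs) hrs
    exact (hPs2 r (hirr r hr)).unique ⟨hAPs r hr, Associated.refl r⟩ ⟨hAPs s hs, has⟩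
  have avoid : ∀ B ⊆ A, ∀ q : R, Prime q → (B ≠ A ∨ ¬ Associated q p) →
      ∃ x, ¬ q ∣ ∏ r ∈ B, (x - r) := by
    intro B hB q hqp hor
    by_cases hex : ∃ r0 ∈ A, Associated q r0
    · obtain ⟨r0, hr0, has⟩ := hex
      have hlt : B.card < Nat.card (R ⧸ Ideal.span {r0}) := by
        by_cases h0 : r0 = p
        · subst h0
          have hne : B ≠ A := by
            rcases hor with h | h
            · exact h
            · exact absurd has h
          rw [← hcard2]
          exact Finset.card_lt_card (Finset.ssubset_iff_subset_ne.mpr ⟨hB, hne⟩)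
        · have := (hq r0 hr0 h0).2
          have h3 := Finset.card_le_card hB
          omega
      obtain ⟨x, hx⟩ := hlp_avoid (hprime r0 hr0) B hlt
      exact ⟨x, fun h => hx (has.dvd_iff_dvd_left.mp h)⟩
    · refine ⟨0, fun h => hex ?_⟩
      obtain ⟨r, hr, hd⟩ := (hqp.dvd_finsetProd_iff _).mp h
      rw [zero_sub, dvd_neg] at hd
      exact ⟨r, hB hr, hqp.irreducible.associated_of_dvd (hirr r (hB hr)) hd⟩
  have hsurj : ∀ x, p ∣ ∏ r ∈ A, (x - r) := by
    intro x
    have h1 : ((fun r => Ideal.Quotient.mk (Ideal.span {p}) r) '' (A : Set R)) = Set.univ := by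
      apply Set.eq_of_subset_of_ncard_le (Set.subset_univ _)
      rw [Set.ncard_univ, ← hcard1, ← hcard2]
    have h2 : Ideal.Quotient.mk (Ideal.span {p}) x ∈
        ((fun r => Ideal.Quotient.mk (Ideal.span {p}) r) '' (A : Set R)) := by
      rw [h1]; trivial
    obtain ⟨r, hr, h3⟩ := h2
    have h4 : Ideal.Quotient.mk (Ideal.span {p}) x = Ideal.Quotient.mk (Ideal.span {p}) r := h3.symm
    rw [Ideal.Quotient.eq, Ideal.mem_span_singleton] at h4
    exact h4.trans (Finset.dvd_prod_of_mem (fun r => x - r) hr)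
  have hp0 : p ≠ 0 := (hirr p hpP).ne_zero
  have hatom : IsMAtom (intnz R) (C (algebraMap R (Kq R) p)⁻¹ * gP A) := by
    refine hlp_atom A ⟨p, hpP⟩ p hp0 hsurj ?_ ?_
    · intro B hB _
      exact ⟨(hirr p hpP).not_isUnit, fun q hqp => avoid B hB.1 q hqp (Or.inl hB.ne)⟩
    · intro q hqp
      by_cases has : Associated q p
      · refine ⟨p + p, fun h => ?_⟩
        have h1 : p * p ∣ ∏ r ∈ A, (p + p - r) :=
          ((has.mul_right p).dvd_iff_dvd_left).mp h
        rw [← Finset.mul_prod_erase A _ hpP, add_sub_cancel_right] at h1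
        have h2 := (mul_dvd_mul_iff_left hp0).mp h1
        obtain ⟨r, hr, hd⟩ := ((hprime p hpP).dvd_finsetProd_iff _).mp h2
        have h3 : p ∣ r := by
          have := (dvd_sub_right (dvd_add (dvd_refl p) (dvd_refl p))).mp hd
          exact this
        rw [Finset.mem_erase] at hr
        exact hr.1 (hdvd p hpP r hr.2 h3).symm
      · obtain ⟨x, hx⟩ := avoid A subset_rfl q hqp (Or.inr has)
        exact ⟨x, fun h => hx ((dvd_mul_right q p).trans h)⟩
  have hpK : algebraMap R (Kq R) p ≠ 0 := by simpa using hp0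
  refine ⟨gP A, ⟨fun x => ⟨_, gP_eval A x⟩, gP_ne A⟩, ?_,
    A.toList.map (fun r => X - C (algebraMap R (Kq R) r)),
    [C (algebraMap R (Kq R) p), C (algebraMap R (Kq R) p)⁻¹ * gP A], ?_, ?_, ?_, ?_, ?_⟩
  · intro hu
    have := hlp_unit_deg hu
    rw [gP_deg] at this
    omega
  · intro f hf
    obtain ⟨r, _, rfl⟩ := List.mem_map.mp hf
    exact hlp_linear_atom r
  · intro f hf
    simp only [List.mem_cons, List.not_mem_nil, or_false] at hf
    rcases hf with rfl | rfl
    · exact hlp_const_atom (hirr p hpP)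
    · exact hatom
  · rw [Finset.prod_map_toList]; rfl
  · simp only [List.prod_cons, List.prod_nil, mul_one]
    rw [← mul_assoc, ← C_mul, mul_inv_cancel₀ hpK, C_1, one_mul]
  · simp only [List.length_cons, List.length_nil, List.length_map, Finset.length_toList]
    omega
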